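/- Let q be a prime power and S a surface of degree d in P^3 over F_q without F_q-plane components, with 2 ≤ d ≤ q+1 and N_q(S) = (d-1)q^2 + dq + 1. Let Z_S be the set of F_q-planes H such that S ∩ H is a planar F_q-pencil of degree d. Then the map Z_S → S(F_q) sending H to the vertex v_{S∩H} is a bijection; in particular #Z_S = N_q(S). -/

import Mathlib

open MvPolynomial

variable {K : Type} [Field K]

/-- The linear form `∑ aᵢ Xᵢ` as a multivariate polynomial. -/
noncomputable def linForm {n : ℕ} (a : Fin n → K) : MvPolynomial (Fin n) K :=
  ∑ i, C (a i) * X i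

/-- The linear form `v ↦ ∑ aᵢ vᵢ` as a linear map. -/
noncomputable def linMap {n : ℕ} (a : Fin n → K) : (Fin n → K) →ₗ[K] K :=
  ∑ i, a i • LinearMap.proj i

/-- Substitution `F(M·X)` of a linear change of variables into `F`. -/
noncomputable def substLin {n : ℕ} (M : Matrix (Fin n) (Fin n) K)
    (F : MvPolynomial (Fin n) K) : MvPolynomial (Fin n) K :=
  MvPolynomial.aeval (fun i => ∑ j, C (M i j) * X j) F

/-- Projective equivalence over `K` of two forms. -/
def ProjEquiv {n : ℕ} (F G : MvPolynomial (Fin n) K) : Prop :=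
  ∃ M : Matrix (Fin n) (Fin n) K, IsUnit M.det ∧
    ∃ c : K, c ≠ 0 ∧ substLin M F = C c * G

/-- An `F_q`-line in `P^3` (resp. `P^2`), as a 2-dimensional linear subspace. -/
def IsLine {n : ℕ} (W : Submodule K (Fin n → K)) : Prop := Module.finrank K W = 2

/-- An `F_q`-plane in `P^3`, as a 3-dimensional linear subspace. -/
def IsPlane (W : Submodule K (Fin 4 → K)) : Prop := Module.finrank K W = 3

/-- The section `S ∩ H` of the surface `S = {F = 0}` with the plane `H` given by the
subspace `W` is a planar `F_q`-pencil of degree `d` with vertex `P`: modulo the linear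
form defining `H`, `F` is a nonzero scalar times a product of `d` linear forms over `F_q`
cutting out `d` pairwise distinct lines of `H`, all passing through the point `P`. -/
def IsPencil (F : MvPolynomial (Fin 4) K) (d : ℕ)
    (W : Submodule K (Fin 4 → K)) (P : Projectivization K (Fin 4 → K)) : Prop :=
  ∃ (a : Fin 4 → K) (m : Fin d → Fin 4 → K) (c : K) (g : MvPolynomial (Fin 4) K),
    a ≠ 0 ∧ W = LinearMap.ker (linMap a) ∧ c ≠ 0 ∧
    F = C c * (∏ i, linForm (m i)) + linForm a * g ∧
    (∀ i, IsLine (LinearMap.ker (linMap a) ⊓ LinearMap.ker (linMap (m i)))) ∧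
    (∀ i j, i ≠ j →
      LinearMap.ker (linMap a) ⊓ LinearMap.ker (linMap (m i)) ≠
      LinearMap.ker (linMap a) ⊓ LinearMap.ker (linMap (m j))) ∧
    P.rep ∈ W ∧ (∀ i, linMap (m i) P.rep = 0)

/-- The restriction of `F` to the plane `H` given by the subspace `W` has a linear
factor over `F_q` (i.e. the section `S ∩ H` has an `F_q`-line component). -/
def SectionHasLineComp (F : MvPolynomial (Fin 4) K)
    (W : Submodule K (Fin 4 → K)) : Prop :=
  ∃ (a b : Fin 4 → K) (h g : MvPolynomial (Fin 4) K),
    a ≠ 0 ∧ W = LinearMap.ker (linMap a) ∧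
    IsLine (LinearMap.ker (linMap a) ⊓ LinearMap.ker (linMap b)) ∧
    F = linForm b * h + linForm a * g

section LinearForms

variable {n : ℕ}

theorem linMap_apply (a x : Fin n → K) : linMap a x = ∑ i, a i * x i := by
  simp [linMap]

theorem linMap_smul_left (s : K) (a x : Fin n → K) : linMap (s • a) x = s * linMap a x := by
  simp [linMap_apply, Finset.mul_sum, mul_assoc]

theorem linMap_sub_left (a b x : Fin n → K) : linMap (a - b) x = linMap a x - linMap b x := by
  simp [linMap_apply, sub_mul]

theorem linMap_single_right (a : Fin n → K) (i : Fin n) :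
    linMap a (Pi.single i 1) = a i := by
  simp [linMap_apply, Pi.single_apply]

theorem exists_linMap_eq (φ : (Fin n → K) →ₗ[K] K) : ∃ a, linMap a = φ := by
  refine ⟨fun i => φ (Pi.single i 1), LinearMap.pi_ext' fun i => ?_⟩
  ext
  simp [linMap_apply, Pi.single_apply]

theorem eval_linForm (a x : Fin n → K) : eval x (linForm a) = linMap a x := by
  simp [linForm, linMap_apply]

theorem linForm_isHomogeneous (a : Fin n → K) : (linForm a).IsHomogeneous 1 := by
  refine IsHomogeneous.sum _ _ _ fun i _ => ?_
  simpa using (isHomogeneous_C (Fin n) (a i)).mul (isHomogeneous_X K i)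

theorem linearIndependent_pair_of_linMap {a m v : Fin n → K} (ha : a ≠ 0) (hav : linMap a v = 0)
    (hmv : linMap m v ≠ 0) : LinearIndependent K ![a, m] := by
  rw [LinearIndependent.pair_iff]
  intro s t h
  have h1 : s * linMap a v + t * linMap m v = 0 := by
    have := congrArg (fun z => linMap z v) h
    simpa [linMap_apply, Finset.mul_sum, mul_assoc, add_mul, Finset.sum_add_distrib] using this
  have ht : t = 0 := by simpa [hav, hmv] using h1
  subst ht
  simpa [ha] using h

theorem linearIndependent_triple_of_linMap {a b m v : Fin n → K}
    (h : LinearIndependent K ![a, m]) (hav : linMap a v = 0) (hbv : linMap b v = 1)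
    (hmv : linMap m v = 0) : LinearIndependent K ![a, b, m] := by
  rw [Fintype.linearIndependent_iff]
  rw [LinearIndependent.pair_iff] at h
  intro g hg
  have hg' : g 0 • a + g 1 • b + g 2 • m = 0 := by simpa [Fin.sum_univ_three] using hg
  have h1 : g 0 * linMap a v + g 1 * linMap b v + g 2 * linMap m v = 0 := by
    have := congrArg (fun z => linMap z v) hg'
    simpa [linMap_apply, Finset.mul_sum, mul_assoc, add_mul, Finset.sum_add_distrib] using this
  have h2 : g 1 = 0 := by simpa [hav, hbv, hmv] using h1
  rw [h2, zero_smul, add_zero] at hg'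
  obtain ⟨h3, h4⟩ := h _ _ hg'
  intro i
  fin_cases i <;> assumption

theorem exists_linMap_eq_of_linearIndependent {k : ℕ} {c : Fin k → Fin n → K}
    (hc : LinearIndependent K c) (s : Fin k → K) : ∃ x, ∀ i, linMap (c i) x = s i := by
  have hr : Matrix.rank (Matrix.of c) = k := by
    simpa using LinearIndependent.rank_matrix (M := Matrix.of c) hc
  have htop : LinearMap.range (Matrix.of c).mulVecLin = ⊤ := by
    apply Submodule.eq_top_of_finrank_eq
    rw [Module.finrank_fin_fun]
    exact hr
  obtain ⟨x, hx⟩ := LinearMap.range_eq_top.1 htop s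
  refine ⟨x, fun i => ?_⟩
  rw [← hx, linMap_apply]
  rfl

theorem finrank_ker_linMap_family {k : ℕ} {c : Fin k → Fin n → K}
    (hc : LinearIndependent K c) :
    Module.finrank K (⨅ i, LinearMap.ker (linMap (c i)) : Submodule K (Fin n → K)) + k = n := by
  have hr : Matrix.rank (Matrix.of c) = k := by
    simpa using LinearIndependent.rank_matrix (M := Matrix.of c) hc
  have h := LinearMap.finrank_range_add_finrank_ker (Matrix.of c).mulVecLin
  rw [Module.finrank_fin_fun] at h
  have hk : (⨅ i, LinearMap.ker (linMap (c i)) : Submodule K (Fin n → K)) =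
      LinearMap.ker (Matrix.of c).mulVecLin := by
    ext x
    simp only [Submodule.mem_iInf, LinearMap.mem_ker, linMap_apply, funext_iff]
    rfl
  rw [hk]
  unfold Matrix.rank at hr
  omega

theorem finrank_ker_linMap {a : Fin n → K} (ha : a ≠ 0) :
    Module.finrank K (LinearMap.ker (linMap a)) + 1 = n := by
  have h := finrank_ker_linMap_family (c := ![a])
    (by simpa [linearIndependent_unique_iff] using ha)
  have hk : (⨅ i, LinearMap.ker (linMap (![a] i)) : Submodule K (Fin n → K)) =
      LinearMap.ker (linMap a) := by
    ext x
    simp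
  rwa [hk] at h

theorem finrank_ker_inf_ker_linMap {a m : Fin n → K} (h : LinearIndependent K ![a, m]) :
    Module.finrank K (LinearMap.ker (linMap a) ⊓ LinearMap.ker (linMap m) :
      Submodule K (Fin n → K)) + 2 = n := by
  have h := finrank_ker_linMap_family h
  have hk : (⨅ i, LinearMap.ker (linMap (![a, m] i)) : Submodule K (Fin n → K)) =
      LinearMap.ker (linMap a) ⊓ LinearMap.ker (linMap m) := by
    ext x
    simp [Fin.forall_fin_two]
  rwa [hk] at h

/-- The level sets of a linearly independent family of linear forms are affine subspaces of the
expected cardinality. -/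
theorem card_linMap_fiber_mul_pow [Fintype K] {k : ℕ} {c : Fin k → Fin n → K}
    (hc : LinearIndependent K c) (s : Fin k → K) :
    Nat.card {x : Fin n → K // ∀ i, linMap (c i) x = s i} * Fintype.card K ^ k =
      Fintype.card K ^ n := by
  obtain ⟨x₀, hx₀⟩ := exists_linMap_eq_of_linearIndependent hc s
  have e : {x : Fin n → K // ∀ i, linMap (c i) x = s i} ≃
      (⨅ i, LinearMap.ker (linMap (c i)) : Submodule K (Fin n → K)) :=
    (Equiv.subRight x₀).subtypeEquiv fun x => by
      simp [hx₀, sub_eq_zero]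
  rw [Nat.card_congr e, Module.natCard_eq_pow_finrank (K := K), Nat.card_eq_fintype_card,
    ← pow_add, finrank_ker_linMap_family hc]

theorem finrank_span_pair {x u : Fin n → K} (h : LinearIndependent K ![x, u]) :
    Module.finrank K (Submodule.span K {x, u}) = 2 := by
  rw [← Matrix.range_cons_cons_empty x u ![], finrank_span_eq_card h, Fintype.card_fin]

theorem ker_inf_ker_eq_span {a m x u : Fin 4 → K} (h : LinearIndependent K ![a, m])
    (hxu : LinearIndependent K ![x, u]) (hax : linMap a x = 0) (hau : linMap a u = 0)
    (hmx : linMap m x = 0) (hmu : linMap m u = 0) :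
    LinearMap.ker (linMap a) ⊓ LinearMap.ker (linMap m) = Submodule.span K {x, u} := by
  symm
  apply Submodule.eq_of_le_of_finrank_eq
  · rw [Submodule.span_le]
    rintro y (rfl | rfl) <;> simp [*]
  · have h1 := finrank_ker_inf_ker_linMap h
    have h2 := finrank_span_pair hxu
    omega

theorem exists_linMap_through {a x u : Fin 4 → K} (ha : a ≠ 0)
    (hxu : LinearIndependent K ![x, u]) :
    ∃ m, LinearIndependent K ![a, m] ∧ linMap m x = 0 ∧ linMap m u = 0 := by
  have h1 := finrank_ker_linMap ha
  have h2 := finrank_span_pair hxu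
  obtain ⟨v, hv, hv'⟩ : ∃ v ∈ LinearMap.ker (linMap a), v ∉ Submodule.span K {x, u} := by
    by_contra! hle
    have := Submodule.finrank_mono (show LinearMap.ker (linMap a) ≤ _ from hle)
    omega
  obtain ⟨φ, hφ, hle⟩ := Submodule.exists_le_ker_of_notMem hv'
  obtain ⟨m, rfl⟩ := exists_linMap_eq φ
  exact ⟨m, linearIndependent_pair_of_linMap ha hv hφ,
    hle (Submodule.subset_span (by simp)), hle (Submodule.subset_span (by simp))⟩

end LinearForms

section LineRestriction

variable {n : ℕ}

/-- The restriction of a polynomial to the parametrized line `t ↦ x + t u`. -/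
noncomputable def lineRes (x u : Fin n → K) : MvPolynomial (Fin n) K →ₐ[K] Polynomial K :=
  aeval fun i => Polynomial.C (x i) + Polynomial.C (u i) * Polynomial.X

/-- The gradient of a polynomial at a point. -/
noncomputable def gradAt (F : MvPolynomial (Fin n) K) (x : Fin n → K) : Fin n → K :=
  fun i => eval x (pderiv i F)

theorem lineRes_X (x u : Fin n → K) (i : Fin n) :
    lineRes x u (X i) = Polynomial.C (x i) + Polynomial.C (u i) * Polynomial.X := by
  simp [lineRes]

theorem lineRes_C (x u : Fin n → K) (c : K) : lineRes x u (C c) = Polynomial.C c :=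
  (lineRes x u).commutes c

theorem lineRes_linForm (x u a : Fin n → K) :
    lineRes x u (linForm a) =
      Polynomial.C (linMap a x) + Polynomial.C (linMap a u) * Polynomial.X := by
  simp [linForm, lineRes_X, linMap_apply, mul_add, Finset.sum_add_distrib,
    Finset.sum_mul, mul_assoc]

theorem eval_lineRes (x u : Fin n → K) (F : MvPolynomial (Fin n) K) (t : K) :
    (lineRes x u F).eval t = eval (x + t • u) F := by
  induction F using MvPolynomial.induction_on with
  | C c => simp
  | add p q hp hq => simp [hp, hq]
  | mul_X p i hp => simp [hp, lineRes_X, mul_comm t]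

theorem coeff_zero_lineRes (x u : Fin n → K) (F : MvPolynomial (Fin n) K) :
    (lineRes x u F).coeff 0 = eval x F := by
  rw [Polynomial.coeff_zero_eq_eval_zero, eval_lineRes, zero_smul, add_zero]

theorem coeff_one_lineRes (x u : Fin n → K) (F : MvPolynomial (Fin n) K) :
    (lineRes x u F).coeff 1 = linMap (gradAt F x) u := by
  rw [linMap_apply]
  induction F using MvPolynomial.induction_on with
  | C c => simp [gradAt]
  | add p q hp hq => simp [hp, hq, gradAt, add_mul, Finset.sum_add_distrib]
  | mul_X p i hp =>
    rw [map_mul, lineRes_X, mul_add, Polynomial.coeff_add, Polynomial.coeff_mul_C, hp,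
      ← mul_assoc, Polynomial.coeff_mul_X, Polynomial.coeff_mul_C, coeff_zero_lineRes]
    have h : ∀ j, gradAt (p * X i) x j * u j =
        (if j = i then eval x p * u j else 0) + gradAt p x j * u j * x i := fun j => by
      by_cases hj : j = i
      · subst hj
        simp [gradAt]
        ring
      · simp [gradAt, pderiv_X, hj, Ne.symm hj]
        ring
    simp [h, Finset.sum_add_distrib, Finset.sum_mul, add_comm]

theorem natDegree_lineRes_X_le (x u : Fin n → K) (i : Fin n) :
    (lineRes x u (X i)).natDegree ≤ 1 := by
  rw [lineRes_X]
  compute_degree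

theorem lineRes_monomial (x u : Fin n → K) (s : Fin n →₀ ℕ) :
    (lineRes x u (monomial s 1)).natDegree ≤ s.degree ∧
      (lineRes x u (monomial s 1)).coeff s.degree = eval u (monomial s (1 : K)) := by
  induction s using Finsupp.induction_linear with
  | zero => simp [lineRes]
  | add f g hf hg =>
    have h : monomial (f + g) (1 : K) = monomial f 1 * monomial g 1 := by simp [monomial_mul]
    rw [h, map_mul, map_mul, map_add]
    exact ⟨Polynomial.natDegree_mul_le_of_le hf.1 hg.1, by
      rw [Polynomial.coeff_mul_add_eq_of_natDegree_le hf.1 hg.1, hf.2, hg.2]⟩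
  | single i k =>
    have h : monomial (Finsupp.single i k) (1 : K) = X i ^ k := by simp [X_pow_eq_monomial]
    have h1 := natDegree_lineRes_X_le x u i
    rw [h, map_pow, map_pow, Finsupp.degree_single]
    refine ⟨by simpa using Polynomial.natDegree_pow_le_of_le k h1, ?_⟩
    have := Polynomial.coeff_pow_of_natDegree_le (m := k) h1
    rw [mul_one] at this
    rw [this, lineRes_X]
    simp [Polynomial.coeff_C]

theorem degree_eq_of_mem_support {F : MvPolynomial (Fin n) K} {d : ℕ} (hF : F.IsHomogeneous d)
    {s : Fin n →₀ ℕ} (hs : s ∈ F.support) : s.degree = d := by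
  rw [Finsupp.degree_eq_weight_one]
  exact hF (mem_support_iff.1 hs)

theorem lineRes_homogeneous {F : MvPolynomial (Fin n) K} {d : ℕ} (hF : F.IsHomogeneous d)
    (x u : Fin n → K) :
    (lineRes x u F).natDegree ≤ d ∧ (lineRes x u F).coeff d = eval u F := by
  have hdeg : ∀ s ∈ F.support, s.degree = d := fun s hs =>
    degree_eq_of_mem_support hF hs
  have hF' : F = ∑ s ∈ F.support, C (coeff s F) * monomial s 1 := by
    conv_lhs => rw [F.as_sum]
    simp [C_mul_monomial]
  constructor
  · conv_lhs => rw [hF']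
    rw [map_sum]
    refine Polynomial.natDegree_sum_le_of_forall_le _ _ fun s hs => ?_
    rw [map_mul, lineRes_C, ← hdeg s hs]
    exact (Polynomial.natDegree_C_mul_le _ _).trans (lineRes_monomial x u s).1
  · conv_lhs => rw [hF']
    conv_rhs => rw [hF']
    rw [map_sum, map_sum, Polynomial.finsetSum_coeff]
    refine Finset.sum_congr rfl fun s hs => ?_
    rw [map_mul, lineRes_C, ← hdeg s hs, map_mul, Polynomial.coeff_C_mul,
      (lineRes_monomial x u s).2, eval_C]

theorem natDegree_lineRes_le {F : MvPolynomial (Fin n) K} {d : ℕ} (hF : F.IsHomogeneous d)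
    (x u : Fin n → K) : (lineRes x u F).natDegree ≤ d :=
  (lineRes_homogeneous hF x u).1

theorem natDegree_lineRes_le_of_eval_eq_zero {F : MvPolynomial (Fin n) K} {d : ℕ}
    (hF : F.IsHomogeneous (d + 1)) {x u : Fin n → K} (hu : eval u F = 0) :
    (lineRes x u F).natDegree ≤ d := by
  have h := lineRes_homogeneous hF x u
  rw [hu] at h
  exact Polynomial.natDegree_le_pred h.1 h.2

theorem aeval_mul_of_isHomogeneous {R : Type*} [CommRing R] [Algebra K R]
    {F : MvPolynomial (Fin n) K} {d : ℕ} (hF : F.IsHomogeneous d) (c : R) (x : Fin n → R) :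
    aeval (fun i => c * x i) F = c ^ d * aeval x F := by
  conv_lhs => rw [F.as_sum]
  conv_rhs => rw [F.as_sum]
  rw [map_sum, map_sum, Finset.mul_sum]
  refine Finset.sum_congr rfl fun s hs => ?_
  have := degree_eq_of_mem_support hF hs
  rw [aeval_monomial, aeval_monomial, ← this, Finsupp.degree_eq_sum, Finsupp.prod_fintype,
    Finsupp.prod_fintype, ← Finset.prod_pow_eq_pow_sum]
  · simp only [mul_pow, Finset.prod_mul_distrib]
    ring
  all_goals simp

theorem eval_smul_of_isHomogeneous {F : MvPolynomial (Fin n) K} {d : ℕ} (hF : F.IsHomogeneous d)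
    (c : K) (x : Fin n → K) : eval (c • x) F = c ^ d * eval x F :=
  aeval_mul_of_isHomogeneous hF c x

theorem lineRes_mul_eq_zero_left {G h : MvPolynomial (Fin n) K} {x u : Fin n → K}
    (hGh : lineRes x u (G * h) = 0) (hG : lineRes x u G ≠ 0) : lineRes x u h = 0 := by
  rw [map_mul] at hGh
  exact (mul_eq_zero.1 hGh).resolve_left hG

theorem eval_direction_eq_zero_of_lineRes_eq_zero {F : MvPolynomial (Fin n) K} {d : ℕ}
    (hF : F.IsHomogeneous d) {x u : Fin n → K} (h : lineRes x u F = 0) : eval u F = 0 := by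
  rw [← (lineRes_homogeneous hF x u).2, h, Polynomial.coeff_zero]

variable [Fintype K]

theorem lineRes_eq_zero_of_gradAt {F : MvPolynomial (Fin n) K} {x u : Fin n → K}
    (hdeg : (lineRes x u F).natDegree ≤ Fintype.card K)
    (hgrad : linMap (gradAt F x) u = 0) (h : ∀ t : K, eval (x + t • u) F = 0) :
    lineRes x u F = 0 := by
  set q := Fintype.card K with hq
  have hq1 : 1 < q := Fintype.one_lt_card
  set p := lineRes x u F with hp
  set r := p - Polynomial.C (p.coeff q) * (Polynomial.X ^ q - Polynomial.X) with hr
  have hrq : r.coeff q = 0 := by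
    simp [hr, Polynomial.coeff_X, hq1.ne]
  have hrdeg : r.natDegree ≤ q := by
    refine (Polynomial.natDegree_sub_le_of_le hdeg
      ((Polynomial.natDegree_C_mul_le _ _).trans ?_)).trans (max_self q).le
    rw [FiniteField.X_pow_card_sub_X_natDegree_eq _ hq1]
  have hrlt : r.natDegree < q := by
    have := Polynomial.natDegree_le_pred hrdeg hrq
    omega
  have hr0 : r = 0 := by
    refine Polynomial.eq_zero_of_natDegree_lt_card_of_eval_eq_zero _ Function.injective_id
      (fun t => ?_) hrlt
    simp [hr, hp, eval_lineRes, h, hq, FiniteField.pow_card]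
  have hp' : p = Polynomial.C (p.coeff q) * (Polynomial.X ^ q - Polynomial.X) := sub_eq_zero.1 hr0
  have h1 : p.coeff 1 = 0 := by rw [hp, coeff_one_lineRes, hgrad]
  have hc : p.coeff q = 0 := by
    rw [hp'] at h1
    simpa [Polynomial.coeff_X_pow, hq1.ne, Polynomial.coeff_X] using h1
  rw [hp', hc]
  simp

open scoped Classical in
theorem card_zeros_on_line_le {F : MvPolynomial (Fin n) K} {x u : Fin n → K}
    (h : lineRes x u F ≠ 0) :
    (Finset.univ.filter fun t : K => eval (x + t • u) F = 0).card ≤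
      (lineRes x u F).natDegree := by
  refine le_trans (Finset.card_le_card fun t ht => ?_)
    ((Multiset.toFinset_card_le (lineRes x u F).roots).trans (Polynomial.card_roots' _))
  simp only [Finset.mem_filter, Finset.mem_univ, true_and] at ht
  rw [Multiset.mem_toFinset, Polynomial.mem_roots h, Polynomial.IsRoot, eval_lineRes, ht]

end LineRestriction

section Division

variable {n : ℕ}

theorem aeval_line_eq_zero {R : Type*} [CommRing R] [IsDomain R] [Algebra K R]
    {F : MvPolynomial (Fin n) K} {d : ℕ} (hF : F.IsHomogeneous d) {x u : Fin n → K}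
    (h : lineRes x u F = 0) (s t : R) :
    aeval (fun i => s * algebraMap K R (x i) + t * algebraMap K R (u i)) F = 0 := by
  by_cases hs : s = 0
  · subst hs
    simp only [zero_mul, zero_add]
    rw [aeval_mul_of_isHomogeneous hF t (fun i => algebraMap K R (u i))]
    have := eval_direction_eq_zero_of_lineRes_eq_zero hF h
    rw [show (fun i => algebraMap K R (u i)) = algebraMap K R ∘ u from rfl,
      aeval_algebraMap_apply]
    change t ^ d * algebraMap K R (eval u F) = 0
    rw [this, map_zero, mul_zero]
  · let L := FractionRing R
    have hinj : Function.Injective (algebraMap R L) := IsFractionRing.injective R L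
    apply hinj
    have hs' : algebraMap R L s ≠ 0 := fun h0 => hs (hinj (by rw [h0, map_zero]))
    set r : L := algebraMap R L t / algebraMap R L s with hr
    have hcomp : ((Polynomial.aeval r).comp (lineRes x u)) =
        aeval fun i => algebraMap K L (x i) + r * algebraMap K L (u i) := by
      apply MvPolynomial.algHom_ext
      intro i
      rw [AlgHom.comp_apply, lineRes_X, aeval_X]
      simp only [map_add, map_mul, Polynomial.aeval_C, Polynomial.aeval_X]
      ring
    have h0 : aeval (fun i => algebraMap K L (x i) + r * algebraMap K L (u i)) F = 0 := by
      rw [← hcomp, AlgHom.comp_apply, h, map_zero]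
    rw [← aeval_algebraMap_apply, map_zero,
      show (algebraMap R L ∘ fun i => s * algebraMap K R (x i) + t * algebraMap K R (u i)) =
        fun i => algebraMap R L s * (algebraMap K L (x i) + r * algebraMap K L (u i)) by
        funext i
        simp only [Function.comp_apply, map_add, map_mul, ← IsScalarTower.algebraMap_apply K R L]
        rw [hr, mul_add, ← mul_assoc, mul_div_cancel₀ _ hs'],
      aeval_mul_of_isHomogeneous hF, h0, mul_zero]

theorem homogeneousComponent_linForm_mul (b : Fin n → K) (h : MvPolynomial (Fin n) K) (e : ℕ) :
    homogeneousComponent (e + 1) (linForm b * h) = linForm b * homogeneousComponent e h := by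
  conv_lhs => rw [← sum_homogeneousComponent h]
  rw [Finset.mul_sum, map_sum]
  have hi : ∀ i, homogeneousComponent (e + 1) (linForm b * homogeneousComponent i h) =
      if i = e then linForm b * homogeneousComponent e h else 0 := fun i => by
    have hm : (linForm b * homogeneousComponent i h).IsHomogeneous (i + 1) := by
      rw [add_comm]
      exact (linForm_isHomogeneous b).mul (homogeneousComponent_isHomogeneous i h)
    rw [homogeneousComponent_of_mem ((mem_homogeneousSubmodule _ _).2 hm)]
    by_cases hie : i = e
    · simp [hie]
    · simp [hie, Ne.symm hie]
  simp_rw [hi]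
  rw [Finset.sum_ite_eq']
  split_ifs with he
  · rfl
  · rw [homogeneousComponent_eq_zero, mul_zero]
    simpa using he

/-- A form of degree `e + 1` that vanishes identically on the line spanned by `x` and `u` lies in
the ideal generated by two linear forms cutting out that line. -/
theorem exists_eq_linForm_mul_add {F : MvPolynomial (Fin 4) K} {e : ℕ}
    (hF : F.IsHomogeneous (e + 1)) {a m x u : Fin 4 → K} (ham : LinearIndependent K ![a, m])
    (hxu : LinearIndependent K ![x, u]) (hax : linMap a x = 0) (hau : linMap a u = 0)
    (hmx : linMap m x = 0) (hmu : linMap m u = 0) (h : lineRes x u F = 0) :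
    ∃ G g : MvPolynomial (Fin 4) K, G.IsHomogeneous e ∧ F = linForm m * G + linForm a * g := by
  obtain ⟨w, hw⟩ := exists_linMap_eq_of_linearIndependent ham ![1, 0]
  obtain ⟨w', hw'⟩ := exists_linMap_eq_of_linearIndependent ham ![0, 1]
  simp only [Fin.forall_fin_two, Matrix.cons_val_zero, Matrix.cons_val_one] at hw hw'
  have hker := ker_inf_ker_eq_span ham hxu hax hau hmx hmu
  have hdec : ∀ j, ∃ α β : K, Pi.single j 1 - a j • w - m j • w' = α • x + β • u := fun j => by
    have hmem : Pi.single j 1 - a j • w - m j • w' ∈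
        LinearMap.ker (linMap a) ⊓ LinearMap.ker (linMap m) := by
      simp [linMap_single_right, hw, hw']
    rw [hker, Submodule.mem_span_pair] at hmem
    obtain ⟨α, β, h⟩ := hmem
    exact ⟨α, β, h.symm⟩
  choose α β hαβ using hdec
  let I : Ideal (MvPolynomial (Fin 4) K) := Ideal.span {linForm m, linForm a}
  have hX : ∀ i, (X i : MvPolynomial (Fin 4) K) =
      (linForm α * C (x i) + linForm β * C (u i)) + (linForm a * C (w i) + linForm m * C (w' i)) :=
      fun i => by
    have hj : ∀ j, (Pi.single j 1 : Fin 4 → K) i =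
        α j * x i + β j * u i + (a j * w i + m j * w' i) := fun j => by
      have := congrFun (hαβ j) i
      simp only [Pi.sub_apply, Pi.add_apply, Pi.smul_apply, smul_eq_mul] at this
      linear_combination this
    have : (X i : MvPolynomial (Fin 4) K) = ∑ j, C ((Pi.single j 1 : Fin 4 → K) i) * X j := by
      simp [Pi.single_apply, apply_ite C]
    rw [this]
    simp only [hj, linForm, Finset.sum_mul, ← Finset.sum_add_distrib]
    refine Finset.sum_congr rfl fun j _ => ?_
    simp only [map_add, map_mul]
    ring
  have hmk : (Ideal.Quotient.mkₐ K I) = (Ideal.Quotient.mkₐ K I).comp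
      (aeval fun i => linForm α * algebraMap K _ (x i) + linForm β * algebraMap K _ (u i)) := by
    apply MvPolynomial.algHom_ext
    intro i
    rw [AlgHom.comp_apply, aeval_X]
    refine Ideal.Quotient.eq.2 ?_
    rw [algebraMap_eq, sub_eq_of_eq_add' (hX i)]
    exact I.add_mem (I.mul_mem_right _ (Ideal.subset_span (by simp)))
      (I.mul_mem_right _ (Ideal.subset_span (by simp)))
  have hFI : F ∈ I := by
    rw [← Ideal.Quotient.eq_zero_iff_mem]
    change Ideal.Quotient.mkₐ K I F = 0
    rw [hmk, AlgHom.comp_apply, aeval_line_eq_zero hF h, map_zero]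
  obtain ⟨G, g, hGg⟩ := Ideal.mem_span_pair.1 hFI
  refine ⟨homogeneousComponent e G, homogeneousComponent e g,
    homogeneousComponent_isHomogeneous e G, ?_⟩
  rw [← homogeneousComponent_linForm_mul, ← homogeneousComponent_linForm_mul, ← map_add,
    mul_comm _ G, mul_comm _ g, hGg, homogeneousComponent_of_mem
      ((mem_homogeneousSubmodule _ _).2 hF), if_pos rfl]

end Division

section AffinePlane

/-- In the affine plane `a = 0, b = 1`, the form `G` of degree `e` cuts out `e` distinct parallel
lines with common direction `u`. -/
def IsParallelUnion (a b : Fin 4 → K) (G : MvPolynomial (Fin 4) K) (e : ℕ) : Prop :=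
  ∃ (u : Fin 4 → K) (m : Fin e → Fin 4 → K) (c : K) (g : MvPolynomial (Fin 4) K),
    u ≠ 0 ∧ linMap a u = 0 ∧ linMap b u = 0 ∧ c ≠ 0 ∧
    G = C c * (∏ i, linForm (m i)) + linForm a * g ∧
    (∀ i, linMap (m i) u = 0) ∧
    (∀ i, ∃ x, linMap a x = 0 ∧ linMap b x = 1 ∧ linMap (m i) x = 0) ∧
    (∀ i, ∃ x, linMap a x = 0 ∧ linMap (m i) x ≠ 0) ∧
    ∀ i j, i ≠ j → ∀ x, linMap a x = 0 → linMap b x = 1 → linMap (m i) x = 0 →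
      linMap (m j) x ≠ 0

theorem eval_mul_add_linForm {n : ℕ} {a x : Fin n → K} (hax : linMap a x = 0)
    (G g : MvPolynomial (Fin n) K) : eval x (G + linForm a * g) = eval x G := by
  rw [map_add, map_mul, eval_linForm, hax, zero_mul, add_zero]

theorem IsParallelUnion.linForm_mul {a b m v x₀ : Fin 4 → K} {G h g : MvPolynomial (Fin 4) K}
    {e : ℕ} (hh : IsParallelUnion a b h e) (hG : G = linForm m * h + linForm a * g)
    (ham : LinearIndependent K ![a, m]) (hv : v ≠ 0) (hav : linMap a v = 0)
    (hbv : linMap b v = 0) (hmv : linMap m v = 0) (hax : linMap a x₀ = 0) (hbx : linMap b x₀ = 1)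
    (hmx : linMap m x₀ = 0)
    (hdisj : ∀ x, linMap a x = 0 → linMap b x = 1 → linMap m x = 0 → eval x h ≠ 0) :
    IsParallelUnion a b G (e + 1) := by
  obtain ⟨u, m', c, g', hu, hau, hbu, hc, hh', hmu, hmz, hmn, hmd⟩ := hh
  have hzero : ∀ i x, linMap a x = 0 → linMap (m' i) x = 0 → eval x h = 0 := fun i x hx hmx => by
    rw [hh', eval_mul_add_linForm hx, map_mul, map_prod, Finset.prod_eq_zero (Finset.mem_univ i),
      mul_zero]
    rw [eval_linForm, hmx]
  obtain ⟨u', hu', hau', hbu', hmu', hm'u'⟩ : ∃ u' : Fin 4 → K, u' ≠ 0 ∧ linMap a u' = 0 ∧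
      linMap b u' = 0 ∧ linMap m u' = 0 ∧ ∀ i, linMap (m' i) u' = 0 := by
    cases e with
    | zero => exact ⟨v, hv, hav, hbv, hmv, fun i => i.elim0⟩
    | succ e =>
      refine ⟨u, hu, hau, hbu, ?_, hmu⟩
      by_contra hne
      obtain ⟨x, hx1, hx2, hx3⟩ := hmz 0
      refine hdisj (x + (-linMap m x / linMap m u) • u) ?_ ?_ ?_ (hzero 0 _ ?_ ?_)
      all_goals simp [hx1, hx2, hx3, hau, hbu, hmu, hne]
  refine ⟨u', Fin.cons m m', c, linForm m * g' + g, hu', hau', hbu', hc, ?_, ?_, ?_, ?_, ?_⟩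
  · rw [Fin.prod_univ_succ, hG, hh']
    simp only [Fin.cons_zero, Fin.cons_succ]
    ring
  · exact Fin.cases hmu' hm'u'
  · exact Fin.cases ⟨x₀, hax, hbx, hmx⟩ hmz
  · refine Fin.cases ?_ hmn
    obtain ⟨x, hx⟩ := exists_linMap_eq_of_linearIndependent ham ![0, 1]
    simp only [Fin.forall_fin_two, Matrix.cons_val_zero, Matrix.cons_val_one] at hx
    exact ⟨x, hx.1, by simp [hx.2]⟩
  · intro i j
    refine Fin.cases ?_ (fun i => ?_) i <;> refine Fin.cases ?_ (fun j => ?_) j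
    · simp
    · intro _ x hax hbx hmx hm'x
      exact hdisj x hax hbx hmx (hzero j x hax hm'x)
    · intro _ x hax hbx hm'x hmx
      exact hdisj x hax hbx hmx (hzero i x hax hm'x)
    · intro hij
      exact hmd i j (fun h => hij (by rw [h]))

theorem not_dvd_of_linForm_mul_add {a m : Fin 4 → K} {G H g : MvPolynomial (Fin 4) K}
    (h : G = linForm m * H + linForm a * g) (hG : ¬ linForm a ∣ G) : ¬ linForm a ∣ H :=
  fun hd => hG (h ▸ dvd_add (hd.mul_left _) (dvd_mul_right _ _))

theorem exists_direction {a b : Fin 4 → K} (hab : LinearIndependent K ![a, b]) :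
    ∃ u : Fin 4 → K, u ≠ 0 ∧ linMap a u = 0 ∧ linMap b u = 0 := by
  have h := finrank_ker_inf_ker_linMap hab
  have hne : (LinearMap.ker (linMap a) ⊓ LinearMap.ker (linMap b) :
      Submodule K (Fin 4 → K)) ≠ ⊥ := fun h0 => by
    rw [h0, finrank_bot] at h
    omega
  obtain ⟨u, hu, hu0⟩ := Submodule.exists_mem_ne_zero_of_ne_bot hne
  exact ⟨u, hu0, hu.1, hu.2⟩

open scoped Classical in
/-- The zeros of a polynomial in a finite set of vectors. -/
noncomputable def zerosIn (A : Finset (Fin 4 → K)) (G : MvPolynomial (Fin 4) K) :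
    Finset (Fin 4 → K) :=
  A.filter fun x => eval x G = 0

theorem mem_zerosIn {A : Finset (Fin 4 → K)} {G : MvPolynomial (Fin 4) K} {x : Fin 4 → K} :
    x ∈ zerosIn A G ↔ x ∈ A ∧ eval x G = 0 := by
  simp [zerosIn]

variable [Fintype K]

open scoped Classical in
/-- The affine plane `a = 0, b = 1`. -/
noncomputable def affinePlane (a b : Fin 4 → K) : Finset (Fin 4 → K) :=
  Finset.univ.filter fun x => linMap a x = 0 ∧ linMap b x = 1

theorem mem_affinePlane {a b x : Fin 4 → K} :
    x ∈ affinePlane a b ↔ linMap a x = 0 ∧ linMap b x = 1 := by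
  simp [affinePlane]

open scoped Classical in
theorem card_filter_linMap_pair {a b : Fin 4 → K} (h : LinearIndependent K ![a, b]) (s t : K) :
    (Finset.univ.filter fun x => linMap a x = s ∧ linMap b x = t).card = Fintype.card K ^ 2 := by
  have h1 := card_linMap_fiber_mul_pow h ![s, t]
  simp only [Fin.forall_fin_two, Matrix.cons_val_zero, Matrix.cons_val_one] at h1
  rw [Nat.card_eq_fintype_card, Fintype.card_subtype] at h1
  have hq : 0 < Fintype.card K ^ 2 := pow_pos Fintype.card_pos 2
  exact Nat.eq_of_mul_eq_mul_right hq (h1.trans (by ring))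

theorem card_affinePlane {a b : Fin 4 → K} (h : LinearIndependent K ![a, b]) :
    (affinePlane a b).card = Fintype.card K ^ 2 :=
  card_filter_linMap_pair h 0 1

theorem card_zerosIn_affinePlane_linForm {a b m : Fin 4 → K}
    (h : LinearIndependent K ![a, b, m]) :
    (zerosIn (affinePlane a b) (linForm m)).card = Fintype.card K := by
  classical
  have h1 := card_linMap_fiber_mul_pow h ![0, 1, 0]
  have h2 : zerosIn (affinePlane a b) (linForm m) =
      Finset.univ.filter fun x => ∀ i, linMap (![a, b, m] i) x = (![0, 1, 0] : Fin 3 → K) i := by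
    ext x
    simp [mem_zerosIn, mem_affinePlane, eval_linForm, Fin.forall_fin_succ, and_assoc]
  rw [Nat.card_eq_fintype_card, Fintype.card_subtype, ← h2] at h1
  have hq : 0 < Fintype.card K ^ 3 := pow_pos Fintype.card_pos 3
  exact Nat.eq_of_mul_eq_mul_right hq (h1.trans (by ring))

open scoped Classical in
theorem sum_card_zeros_on_lines {A : Finset (Fin 4 → K)} {u : Fin 4 → K}
    (hA : ∀ x ∈ A, ∀ t : K, x + t • u ∈ A) (G : MvPolynomial (Fin 4) K) :
    ∑ x ∈ A, (Finset.univ.filter fun t : K => eval (x + t • u) G = 0).card =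
      Fintype.card K * (zerosIn A G).card := by
  have h := Finset.sum_card_bipartiteAbove_eq_sum_card_bipartiteBelow
    (s := A) (t := (Finset.univ : Finset K)) (fun x t => eval (x + t • u) G = 0)
  unfold Finset.bipartiteAbove Finset.bipartiteBelow at h
  rw [h, Finset.sum_const_nat (m := (zerosIn A G).card), Finset.card_univ]
  intro t _
  refine Finset.card_nbij' (fun x => x + t • u) (fun x => x - t • u) ?_ ?_ ?_ ?_
  · intro x hx
    simp only [Finset.mem_coe, Finset.mem_filter, mem_zerosIn] at hx ⊢
    exact ⟨hA x hx.1 t, hx.2⟩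
  · intro x hx
    simp only [Finset.mem_coe, Finset.mem_filter, mem_zerosIn] at hx ⊢
    refine ⟨?_, by simpa using hx.2⟩
    have := hA x hx.1 (-t)
    rwa [neg_smul, ← sub_eq_add_neg] at this
  · intro x _
    simp
  · intro x _
    simp

open scoped Classical in
theorem sum_card_zeros_through_point {a b p : Fin 4 → K} (hp : p ∈ affinePlane a b)
    {G : MvPolynomial (Fin 4) K} (hG : eval p G = 0) :
    ∑ u ∈ (Finset.univ.filter fun u => linMap a u = 0 ∧ linMap b u = 0).erase 0,
        ((Finset.univ.erase 0).filter fun t : K => eval (p + t • u) G = 0).card =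
      (Fintype.card K - 1) * ((zerosIn (affinePlane a b) G).card - 1) := by
  rw [mem_affinePlane] at hp
  have hpz : p ∈ zerosIn (affinePlane a b) G := by
    rw [mem_zerosIn, mem_affinePlane]
    exact ⟨hp, hG⟩
  have h := Finset.sum_card_bipartiteAbove_eq_sum_card_bipartiteBelow
    (s := (Finset.univ.filter fun u => linMap a u = 0 ∧ linMap b u = 0).erase 0)
    (t := (Finset.univ.erase 0 : Finset K)) (fun u t => eval (p + t • u) G = 0)
  unfold Finset.bipartiteAbove Finset.bipartiteBelow at h
  rw [h, Finset.sum_const_nat (m := (zerosIn (affinePlane a b) G).card - 1),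
    Finset.card_erase_of_mem (Finset.mem_univ _), Finset.card_univ]
  intro t ht
  have ht0 : t ≠ 0 := Finset.ne_of_mem_erase ht
  rw [← Finset.card_erase_of_mem hpz]
  refine Finset.card_nbij' (fun u => p + t • u) (fun x => t⁻¹ • (x - p)) ?_ ?_ ?_ ?_
  · intro u hu
    simp only [Finset.mem_coe, Finset.mem_filter, Finset.mem_erase, mem_zerosIn, mem_affinePlane,
      Finset.mem_univ, true_and] at hu ⊢
    refine ⟨?_, ?_, hu.2⟩
    · simpa [ht0] using hu.1.1
    · simp [hp, hu.1.2]
  · intro x hx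
    simp only [Finset.mem_coe, Finset.mem_filter, Finset.mem_erase, mem_zerosIn, mem_affinePlane,
      Finset.mem_univ, true_and] at hx ⊢
    refine ⟨⟨?_, ?_⟩, ?_⟩
    · simpa [ht0, sub_eq_zero] using hx.1
    · simp [hp, hx.2.1]
    · simpa [smul_smul, ht0] using hx.2.2
  · intro u _
    simp [smul_smul, ht0]
  · intro x _
    simp [smul_smul, ht0]

/-- Splitting off a line contained in the zero set of a form. -/
theorem exists_factor_of_lineRes_eq_zero {a b x u : Fin 4 → K} {G : MvPolynomial (Fin 4) K}
    {e : ℕ} (hab : LinearIndependent K ![a, b]) (hG : G.IsHomogeneous (e + 1))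
    (hx : x ∈ affinePlane a b) (hu : u ≠ 0) (hau : linMap a u = 0) (hbu : linMap b u = 0)
    (h : lineRes x u G = 0) :
    ∃ (m : Fin 4 → K) (H g : MvPolynomial (Fin 4) K), LinearIndependent K ![a, m] ∧
      linMap m x = 0 ∧ linMap m u = 0 ∧ H.IsHomogeneous e ∧ G = linForm m * H + linForm a * g ∧
      (zerosIn (affinePlane a b) (linForm m)).card = Fintype.card K := by
  rw [mem_affinePlane] at hx
  have ha : a ≠ 0 := by simpa using hab.ne_zero 0
  have hxu : LinearIndependent K ![x, u] := by
    rw [LinearIndependent.pair_iff' (by rintro rfl; simp at hx)]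
    rintro s rfl
    simp [hx.2] at hbu
    exact hu (by simp [hbu])
  obtain ⟨m, ham, hmx, hmu⟩ := exists_linMap_through ha hxu
  obtain ⟨H, g, hH, hGH⟩ := exists_eq_linForm_mul_add hG ham hxu hx.1 hau hmx hmu h
  exact ⟨m, H, g, ham, hmx, hmu, hH, hGH,
    card_zerosIn_affinePlane_linForm (linearIndependent_triple_of_linMap ham hx.1 hx.2 hmx)⟩

open scoped Classical in
theorem zerosIn_linForm_mul_add {a b m : Fin 4 → K} {G H g : MvPolynomial (Fin 4) K}
    (h : G = linForm m * H + linForm a * g) :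
    zerosIn (affinePlane a b) G =
      zerosIn (affinePlane a b) (linForm m) ∪ zerosIn (affinePlane a b) H := by
  ext x
  simp only [Finset.mem_union, mem_zerosIn, ← and_or_left]
  refine and_congr_right fun hx => ?_
  rw [mem_affinePlane] at hx
  rw [h, eval_mul_add_linForm hx.1, map_mul, mul_eq_zero]

theorem card_zerosIn_affinePlane_le {a b : Fin 4 → K} (hab : LinearIndependent K ![a, b])
    {G : MvPolynomial (Fin 4) K} {e : ℕ} (hG : G.IsHomogeneous e) (he : e < Fintype.card K)
    (hGa : ¬ linForm a ∣ G) : (zerosIn (affinePlane a b) G).card ≤ e * Fintype.card K := by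
  classical
  induction e generalizing G with
  | zero =>
    obtain ⟨c, rfl⟩ : ∃ c, G = C c := ⟨_, totalDegree_eq_zero_iff_eq_C.1
      ((totalDegree_zero_iff_isHomogeneous _).2 hG)⟩
    have hc : c ≠ 0 := by
      rintro rfl
      simp at hGa
    simp [zerosIn, hc]
  | succ e ih =>
    obtain ⟨u, hu, hau, hbu⟩ := exists_direction hab
    by_cases hline : ∃ x ∈ affinePlane a b, lineRes x u G = 0
    · obtain ⟨x, hx, hxu⟩ := hline
      obtain ⟨m, H, g, ham, hmx, hmu, hH, hGH, hcard⟩ :=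
        exists_factor_of_lineRes_eq_zero hab hG hx hu hau hbu hxu
      rw [zerosIn_linForm_mul_add hGH]
      refine (Finset.card_union_le _ _).trans ?_
      rw [hcard, add_mul, one_mul, add_comm]
      exact Nat.add_le_add_right
        (ih hH (by omega) (not_dvd_of_linForm_mul_add hGH hGa)) _
    · push Not at hline
      have hsum := sum_card_zeros_on_lines (A := affinePlane a b) (u := u) (fun x hx t => by
        rw [mem_affinePlane] at hx ⊢
        simp [hx, hau, hbu]) G
      have hle : ∑ x ∈ affinePlane a b,
          (Finset.univ.filter fun t : K => eval (x + t • u) G = 0).card ≤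
          (affinePlane a b).card * (e + 1) :=
        Finset.sum_le_card_nsmul _ _ _ fun x hx =>
          (card_zeros_on_line_le (hline x hx)).trans (natDegree_lineRes_le hG x u)
      rw [hsum, card_affinePlane hab] at hle
      have hq : 0 < Fintype.card K := Fintype.card_pos
      refine Nat.le_of_mul_le_mul_left (hle.trans (le_of_eq ?_)) hq
      ring

theorem exists_lineRes_eq_zero_of_card_eq {a b : Fin 4 → K}
    (hab : LinearIndependent K ![a, b]) {G : MvPolynomial (Fin 4) K} {e : ℕ}
    (hG : G.IsHomogeneous (e + 1)) (he : e + 1 < Fintype.card K)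
    (hcard : (zerosIn (affinePlane a b) G).card = (e + 1) * Fintype.card K) :
    ∃ x ∈ affinePlane a b, ∃ u : Fin 4 → K, u ≠ 0 ∧ linMap a u = 0 ∧ linMap b u = 0 ∧
      lineRes x u G = 0 := by
  classical
  by_contra! hno
  have hq : 0 < Fintype.card K := Fintype.card_pos
  obtain ⟨p, hp⟩ := Finset.card_pos.1 (hcard ▸ Nat.mul_pos (Nat.succ_pos e) hq)
  rw [mem_zerosIn] at hp
  have hsum := sum_card_zeros_through_point hp.1 hp.2
  have hle : ∑ u ∈ (Finset.univ.filter fun u => linMap a u = 0 ∧ linMap b u = 0).erase 0,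
      ((Finset.univ.erase 0).filter fun t : K => eval (p + t • u) G = 0).card ≤
      ((Finset.univ.filter fun u => linMap a u = 0 ∧ linMap b u = 0).erase 0).card * e := by
    refine Finset.sum_le_card_nsmul _ _ _ fun u hu => ?_
    simp only [Finset.mem_erase, Finset.mem_filter, Finset.mem_univ, true_and] at hu
    have h1 := (card_zeros_on_line_le (hno p hp.1 u hu.1 hu.2.1 hu.2.2)).trans
      (natDegree_lineRes_le hG p u)
    rw [Finset.filter_erase, Finset.card_erase_of_mem (by simpa using hp.2)]
    omega
  rw [hsum, Finset.card_erase_of_mem (by simp), card_filter_linMap_pair hab, hcard] at hle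
  obtain ⟨k, hk⟩ : ∃ k, Fintype.card K = e + k + 2 := ⟨Fintype.card K - e - 2, by omega⟩
  rw [hk] at hle
  have h1 : e + k + 2 - 1 = e + k + 1 := rfl
  have h2 : (e + 1) * (e + k + 2) - 1 = e * (e + k + 3) + (k + 1) := by
    rw [Nat.sub_eq_iff_eq_add (by nlinarith)]
    ring
  have h3 : (e + k + 2) ^ 2 - 1 = (e + k + 1) * (e + k + 3) := by
    rw [Nat.sub_eq_iff_eq_add (by nlinarith)]
    ring
  rw [h1, h2, h3, mul_assoc] at hle
  have := Nat.le_of_mul_le_mul_left hle (by omega)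
  nlinarith

theorem isParallelUnion_of_card_eq {a b : Fin 4 → K} (hab : LinearIndependent K ![a, b])
    {G : MvPolynomial (Fin 4) K} {e : ℕ} (hG : G.IsHomogeneous e) (he : e < Fintype.card K)
    (hGa : ¬ linForm a ∣ G)
    (hcard : (zerosIn (affinePlane a b) G).card = e * Fintype.card K) :
    IsParallelUnion a b G e := by
  classical
  induction e generalizing G with
  | zero =>
    obtain ⟨c, rfl⟩ : ∃ c, G = C c := ⟨_, totalDegree_eq_zero_iff_eq_C.1
      ((totalDegree_zero_iff_isHomogeneous _).2 hG)⟩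
    have hc : c ≠ 0 := by
      rintro rfl
      simp at hGa
    obtain ⟨u, hu, hau, hbu⟩ := exists_direction hab
    exact ⟨u, Fin.elim0, c, 0, hu, hau, hbu, hc, by simp, fun i => i.elim0, fun i => i.elim0,
      fun i => i.elim0, fun i => i.elim0⟩
  | succ e ih =>
    obtain ⟨x, hx, u, hu, hau, hbu, hxu⟩ := exists_lineRes_eq_zero_of_card_eq hab hG he hcard
    obtain ⟨m, H, g, ham, hmx, hmu, hH, hGH, hmcard⟩ :=
      exists_factor_of_lineRes_eq_zero hab hG hx hu hau hbu hxu
    have hHa := not_dvd_of_linForm_mul_add hGH hGa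
    have hle := card_zerosIn_affinePlane_le hab hH (by omega) hHa
    have hunion := Finset.card_union_add_card_inter
      (zerosIn (affinePlane a b) (linForm m)) (zerosIn (affinePlane a b) H)
    rw [← zerosIn_linForm_mul_add hGH, hcard, hmcard, add_mul, one_mul] at hunion
    have hinter : zerosIn (affinePlane a b) (linForm m) ∩ zerosIn (affinePlane a b) H = ∅ := by
      rw [← Finset.card_eq_zero]
      omega
    have hx' := mem_affinePlane.1 hx
    refine (ih hH (by omega) hHa (by omega)).linForm_mul hGH ham hu hau hbu hmu hx'.1 hx'.2 hmx
      fun y hay hby hmy hHy => ?_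
    have hy := mem_affinePlane.2 ⟨hay, hby⟩
    have : y ∈ zerosIn (affinePlane a b) (linForm m) ∩ zerosIn (affinePlane a b) H :=
      Finset.mem_inter.2 ⟨mem_zerosIn.2 ⟨hy, by rw [eval_linForm, hmy]⟩, mem_zerosIn.2 ⟨hy, hHy⟩⟩
    rw [hinter] at this
    simp at this

end AffinePlane

section Pencil

theorem isLine_ker_inf_ker {a m : Fin 4 → K} (h : LinearIndependent K ![a, m]) :
    IsLine (LinearMap.ker (linMap a) ⊓ LinearMap.ker (linMap m)) := by
  have := finrank_ker_inf_ker_linMap h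
  unfold IsLine
  omega

theorem exists_linMap_ne_zero_of_isLine {a m : Fin 4 → K} (ha : a ≠ 0)
    (h : IsLine (LinearMap.ker (linMap a) ⊓ LinearMap.ker (linMap m))) :
    ∃ u, linMap a u = 0 ∧ linMap m u ≠ 0 := by
  by_contra! hno
  have hle : LinearMap.ker (linMap a) ≤ LinearMap.ker (linMap m) := fun u hu => hno u hu
  rw [IsLine, inf_eq_left.2 hle] at h
  have := finrank_ker_linMap ha
  omega

theorem IsParallelUnion.exists_isPencil {a b : Fin 4 → K} {F h g : MvPolynomial (Fin 4) K} {e : ℕ}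
    (hh : IsParallelUnion a b h e) (hab : LinearIndependent K ![a, b])
    (hF : F = linForm b * h + linForm a * g) :
    ∃ P, IsPencil F (e + 1) (LinearMap.ker (linMap a)) P := by
  have ha : a ≠ 0 := by simpa using hab.ne_zero 0
  obtain ⟨u, m, c, g', hu, hau, hbu, hc, hh', hmu, hmz, hmn, hmd⟩ := hh
  obtain ⟨s, hs⟩ := Projectivization.exists_smul_eq_mk_rep K u hu
  have hrep : ∀ l : Fin 4 → K, linMap l u = 0 →
      linMap l (Projectivization.mk K u hu).rep = 0 := fun l hl => by
    rw [← hs, Units.smul_def, map_smul, hl, smul_zero]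
  refine ⟨Projectivization.mk K u hu, a, Fin.cons b m, c, linForm b * g' + g, ha, rfl, hc, ?_, ?_,
    ?_, hrep a hau, ?_⟩
  · rw [Fin.prod_univ_succ, hF, hh']
    simp only [Fin.cons_zero, Fin.cons_succ]
    ring
  · refine Fin.cases (isLine_ker_inf_ker hab) fun i => ?_
    obtain ⟨x, hax, hmx⟩ := hmn i
    exact isLine_ker_inf_ker (linearIndependent_pair_of_linMap ha hax hmx)
  · have hb : ∀ i, LinearMap.ker (linMap a) ⊓ LinearMap.ker (linMap b) ≠
        LinearMap.ker (linMap a) ⊓ LinearMap.ker (linMap (m i)) := fun i heq => by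
      obtain ⟨x, hax, hbx, hmx⟩ := hmz i
      have hx : x ∈ LinearMap.ker (linMap a) ⊓ LinearMap.ker (linMap b) := heq ▸ ⟨hax, hmx⟩
      exact one_ne_zero (hbx.symm.trans hx.2)
    intro i j
    refine Fin.cases ?_ (fun i => ?_) i <;> refine Fin.cases ?_ (fun j => ?_) j
    · simp
    · exact fun _ => hb j
    · exact fun _ => (hb i).symm
    · intro hij heq
      obtain ⟨x, hax, hbx, hmx⟩ := hmz i
      simp only [Fin.cons_succ] at heq
      have hx : x ∈ LinearMap.ker (linMap a) ⊓ LinearMap.ker (linMap (m j)) := heq ▸ ⟨hax, hmx⟩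
      exact hmd i j (fun h => hij (by rw [h])) x hax hbx hmx hx.2
  · exact Fin.cases (hrep b hbu) fun i => hrep (m i) (hmu i)

variable {F : MvPolynomial (Fin 4) K} {d : ℕ} {W : Submodule K (Fin 4 → K)}
  {P : Projectivization K (Fin 4 → K)}

theorem IsPencil.exists_gradAt_ne_zero (h : IsPencil F d W P) {v : Fin 4 → K} (hv : v ∈ W)
    (hFv : eval v F = 0) (hvP : LinearIndependent K ![v, P.rep]) :
    ∃ u ∈ W, linMap (gradAt F v) u ≠ 0 := by
  obtain ⟨a, m, c, g, ha, rfl, hc, rfl, hline, hdist, haP, hmP⟩ := h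
  have hav : linMap a v = 0 := hv
  rw [eval_mul_add_linForm hav, map_mul, eval_C, map_prod] at hFv
  obtain ⟨j, -, hj⟩ := Finset.prod_eq_zero_iff.1 ((mul_eq_zero.1 hFv).resolve_left hc)
  rw [eval_linForm] at hj
  have hspan : ∀ i, linMap (m i) v = 0 → LinearMap.ker (linMap a) ⊓ LinearMap.ker (linMap (m i)) =
      Submodule.span K {v, P.rep} := fun i hi => by
    obtain ⟨u, hau, hmu⟩ := exists_linMap_ne_zero_of_isLine ha (hline i)
    exact ker_inf_ker_eq_span (linearIndependent_pair_of_linMap ha hau hmu) hvP hav haP hi (hmP i)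
  obtain ⟨u, hau, hmu⟩ := exists_linMap_ne_zero_of_isLine ha (hline j)
  refine ⟨u, hau, ?_⟩
  rw [← coeff_one_lineRes, map_add, map_mul, map_mul, map_prod, lineRes_C]
  simp only [lineRes_linForm, hav, hau]
  rw [← Finset.mul_prod_erase _ _ (Finset.mem_univ j), hj]
  simp only [map_zero, zero_mul, add_zero, zero_add]
  rw [Polynomial.coeff_C_mul, mul_assoc, Polynomial.coeff_C_mul, Polynomial.coeff_X_mul,
    Polynomial.coeff_zero_eq_eval_zero, Polynomial.eval_prod]
  refine mul_ne_zero hc (mul_ne_zero hmu (Finset.prod_ne_zero_iff.2 fun i hi => ?_))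
  simp only [Polynomial.eval_add, Polynomial.eval_C, Polynomial.eval_mul, Polynomial.eval_X,
    mul_zero, add_zero]
  exact fun hi0 => hdist i j (Finset.ne_of_mem_erase hi) ((hspan i hi0).trans (hspan j hj).symm)

theorem IsPencil.lineRes_vertex (h : IsPencil F d W P) {u : Fin 4 → K} (hu : u ∈ W) :
    ∃ r : K, lineRes P.rep u F = Polynomial.C r * Polynomial.X ^ d := by
  obtain ⟨a, m, c, g, ha, rfl, hc, rfl, hline, hdist, haP, hmP⟩ := h
  have hau : linMap a u = 0 := hu
  have haP' : linMap a P.rep = 0 := haP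
  refine ⟨c * ∏ i, linMap (m i) u, ?_⟩
  rw [map_add, map_mul, map_mul, map_prod, lineRes_C]
  simp only [lineRes_linForm, haP', hau, hmP, Polynomial.C_mul, map_prod, map_zero, zero_add,
    zero_mul, add_zero, Finset.prod_mul_distrib, Finset.prod_const, Finset.card_univ,
    Fintype.card_fin, mul_assoc]

theorem IsPencil.gradAt_vertex (h : IsPencil F d W P) (hd : 2 ≤ d) {u : Fin 4 → K} (hu : u ∈ W) :
    linMap (gradAt F P.rep) u = 0 := by
  obtain ⟨r, hr⟩ := h.lineRes_vertex hu
  rw [← coeff_one_lineRes, hr, Polynomial.coeff_C_mul, Polynomial.coeff_X_pow,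
    if_neg (by omega), mul_zero]

theorem IsPencil.eval_vertex (h : IsPencil F d W P) (hd : 2 ≤ d) : eval P.rep F = 0 := by
  obtain ⟨r, hr⟩ := h.lineRes_vertex W.zero_mem
  rw [← coeff_zero_lineRes P.rep 0, hr, Polynomial.coeff_C_mul, Polynomial.coeff_X_pow,
    if_neg (by omega), mul_zero]

theorem IsPencil.vertex_mem (h : IsPencil F d W P) : P.rep ∈ W := by
  obtain ⟨a, m, c, g, -, -, -, -, -, -, hP, -⟩ := h
  exact hP

/-- The vertex of a pencil is the only point where the surface is tangent to its plane. -/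
theorem IsPencil.eq_vertex (h : IsPencil F d W P) {Q : Projectivization K (Fin 4 → K)}
    (hQ : Q.rep ∈ W) (hFQ : eval Q.rep F = 0) (hgrad : ∀ u ∈ W, linMap (gradAt F Q.rep) u = 0) :
    Q = P := by
  by_contra hne
  obtain ⟨u, hu, hgu⟩ := h.exists_gradAt_ne_zero hQ hFQ (by
    rw [LinearIndependent.pair_iff' Q.rep_nonzero]
    intro s hs
    apply hne
    rw [← Q.mk_rep, ← P.mk_rep, eq_comm, Projectivization.mk_eq_mk_iff']
    exact ⟨s, hs⟩)
  exact hgu (hgrad u hu)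

end Pencil

section LinesOnSurface

theorem lineRes_eq_zero_of_mem_span {n : ℕ} {F : MvPolynomial (Fin n) K} {d : ℕ}
    (hF : F.IsHomogeneous d) {x u x' u' : Fin n → K} (h : lineRes x u F = 0)
    (hx' : x' ∈ Submodule.span K {x, u}) (hu' : u' ∈ Submodule.span K {x, u}) :
    lineRes x' u' F = 0 := by
  obtain ⟨s, t, rfl⟩ := Submodule.mem_span_pair.1 hx'
  obtain ⟨s', t', rfl⟩ := Submodule.mem_span_pair.1 hu'
  refine Eq.trans ?_ (aeval_line_eq_zero hF h (Polynomial.C s + Polynomial.C s' * Polynomial.X)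
    (Polynomial.C t + Polynomial.C t' * Polynomial.X))
  refine congrArg (fun φ => aeval φ F) (funext fun i => ?_)
  simp only [Pi.add_apply, Pi.smul_apply, smul_eq_mul, map_add, map_mul,
    ← Polynomial.C_eq_algebraMap]
  ring

theorem lineRes_eq_zero_symm {n : ℕ} {F : MvPolynomial (Fin n) K} {d : ℕ}
    (hF : F.IsHomogeneous d) {x u : Fin n → K} (h : lineRes x u F = 0) : lineRes u x F = 0 :=
  lineRes_eq_zero_of_mem_span hF h (Submodule.subset_span (by simp))
    (Submodule.subset_span (by simp))

theorem exists_linMap_eq_zero_linearIndependent {p : Fin 4 → K} (hp : p ≠ 0) (g : Fin 4 → K) :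
    ∃ y, LinearIndependent K ![p, y] ∧ linMap g y = 0 := by
  obtain ⟨a, ha, hag⟩ : ∃ a : Fin 4 → K, a ≠ 0 ∧ ∀ y, linMap a y = 0 → linMap g y = 0 := by
    by_cases hg : g = 0
    · exact ⟨Pi.single 0 1, by simp, fun y _ => by simp [hg, linMap_apply]⟩
    · exact ⟨g, hg, fun y hy => hy⟩
  have h1 := finrank_ker_linMap ha
  have h2 := finrank_span_singleton (K := K) hp
  obtain ⟨y, hy, hyp⟩ : ∃ y ∈ LinearMap.ker (linMap a), y ∉ Submodule.span K {p} := by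
    by_contra! hle
    have := Submodule.finrank_mono (show LinearMap.ker (linMap a) ≤ Submodule.span K {p} from hle)
    omega
  refine ⟨y, (LinearIndependent.pair_iff' hp).2 fun s hs => hyp ?_, hag y hy⟩
  exact Submodule.mem_span_singleton.2 ⟨s, hs⟩

/-- A plane containing a line of the surface and tangent to the surface at a point of the line. -/
theorem exists_tangent_plane_of_line {F : MvPolynomial (Fin 4) K} {d : ℕ} (hF : F.IsHomogeneous d)
    {x u : Fin 4 → K} (hxu : LinearIndependent K ![x, u]) (h : lineRes x u F = 0) :
    ∃ a : Fin 4 → K, a ≠ 0 ∧ linMap a x = 0 ∧ linMap a u = 0 ∧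
      ∀ y, linMap a y = 0 → linMap (gradAt F x) y = 0 := by
  have hspan : ∀ y ∈ Submodule.span K {x, u}, linMap (gradAt F x) y = 0 := fun y hy => by
    rw [← coeff_one_lineRes, lineRes_eq_zero_of_mem_span hF h (Submodule.subset_span (by simp)) hy,
      Polynomial.coeff_zero]
  by_cases hg : gradAt F x = 0
  · obtain ⟨m, hm, hmx, hmu⟩ := exists_linMap_through (a := Pi.single 0 1) (by simp) hxu
    exact ⟨m, by simpa using hm.ne_zero 1, hmx, hmu, fun y _ => by simp [hg, linMap_apply]⟩
  · exact ⟨gradAt F x, hg, hspan x (Submodule.subset_span (by simp)),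
      hspan u (Submodule.subset_span (by simp)), fun y hy => hy⟩

variable [Fintype K]

open scoped Classical in
theorem card_zerosIn_univ {F : MvPolynomial (Fin 4) K} {d : ℕ} (hF : F.IsHomogeneous d)
    (hd : d ≠ 0) :
    (zerosIn Finset.univ F).card =
      Nat.card {P : Projectivization K (Fin 4 → K) // eval P.rep F = 0} *
        (Fintype.card K - 1) + 1 := by
  have h0 : (0 : Fin 4 → K) ∈ zerosIn Finset.univ F := by
    have := eval_smul_of_isHomogeneous hF 0 0
    rw [zero_smul, zero_pow hd, zero_mul] at this
    exact mem_zerosIn.2 ⟨Finset.mem_univ _, this⟩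
  let f : {P : Projectivization K (Fin 4 → K) // eval P.rep F = 0} × Kˣ →
      {v // v ∈ (zerosIn Finset.univ F).erase 0} := fun x =>
    ⟨(x.2 : K) • x.1.1.rep, by
      simp [mem_zerosIn, eval_smul_of_isHomogeneous hF, x.1.2, x.1.1.rep_nonzero]⟩
  have hf : Function.Bijective f := by
    constructor
    · rintro ⟨⟨P, hP⟩, s⟩ ⟨⟨Q, hQ⟩, t⟩ h
      have h : (s : K) • P.rep = (t : K) • Q.rep := congrArg Subtype.val h
      have hPQ : P = Q := by
        rw [← P.mk_rep, ← Q.mk_rep, Projectivization.mk_eq_mk_iff']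
        refine ⟨(s : K)⁻¹ * t, ?_⟩
        rw [mul_smul, ← h, smul_smul, inv_mul_cancel₀ s.ne_zero, one_smul]
      subst hPQ
      have := smul_left_injective K P.rep_nonzero h
      simp [Units.ext this]
    · rintro ⟨v, hv⟩
      simp only [Finset.mem_erase, mem_zerosIn, Finset.mem_univ, true_and] at hv
      obtain ⟨s, hs⟩ := Projectivization.exists_smul_eq_mk_rep K v hv.1
      refine ⟨⟨⟨Projectivization.mk K v hv.1, ?_⟩, s⁻¹⟩, Subtype.ext ?_⟩
      · rw [← hs, Units.smul_def, eval_smul_of_isHomogeneous hF, hv.2, mul_zero]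
      · change ((s⁻¹ : Kˣ) : K) • (Projectivization.mk K v hv.1).rep = v
        rw [← hs, ← Units.smul_def, smul_smul, inv_mul_cancel, one_smul]
  have h := Nat.card_congr (Equiv.ofBijective f hf)
  rw [Nat.card_prod, Nat.card_eq_fintype_card (α := Kˣ), Fintype.card_units,
    Nat.card_eq_fintype_card (α := {v // v ∈ (zerosIn Finset.univ F).erase 0}),
    Fintype.card_coe] at h
  rw [h, Finset.card_erase_add_one h0]

theorem eval_eq_zero_of_card_zerosIn {F : MvPolynomial (Fin 4) K}
    (hZ : (zerosIn Finset.univ F).card + Fintype.card K * Fintype.card K =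
      Fintype.card K * Fintype.card K ^ 3 + Fintype.card K ^ 2) (x : Fin 4 → K) :
    eval x F = 0 := by
  have h : zerosIn Finset.univ F = Finset.univ := by
    rw [← Finset.card_eq_iff_eq_univ, Fintype.card_fun, Fintype.card_fin]
    linarith
  exact (mem_zerosIn.1 (h ▸ Finset.mem_univ x)).2

/-- Every rational point of the surface lies on a rational line contained in the surface. -/
theorem exists_line_through_point {F : MvPolynomial (Fin 4) K} {e : ℕ}
    (hF : F.IsHomogeneous (e + 1)) (he : e ≤ Fintype.card K)
    (hZ : (zerosIn Finset.univ F).card + e * Fintype.card K =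
      e * Fintype.card K ^ 3 + Fintype.card K ^ 2)
    {p : Fin 4 → K} (hp : p ≠ 0) (hFp : eval p F = 0) :
    ∃ y, LinearIndependent K ![p, y] ∧ lineRes p y F = 0 := by
  classical
  rcases he.eq_or_lt with rfl | he
  · have hF0 := eval_eq_zero_of_card_zerosIn hZ
    obtain ⟨y, hpy, hy⟩ := exists_linMap_eq_zero_linearIndependent hp (gradAt F p)
    exact ⟨y, hpy, lineRes_eq_zero_of_gradAt (natDegree_lineRes_le_of_eval_eq_zero hF (hF0 y)) hy
      fun t => hF0 _⟩
  · by_contra! hno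
    set q := Fintype.card K with hq
    have hq1 : 1 < q := Fintype.one_lt_card
    let B : Finset (Fin 4 → K) := Finset.univ.image fun s : K => s • p
    have hB : B.card = q := by
      rw [Finset.card_image_of_injective _ (smul_left_injective K hp), Finset.card_univ]
    have hsum := sum_card_zeros_on_lines (A := Finset.univ) (u := p)
      (fun _ _ _ => Finset.mem_univ _) F
    rw [← Finset.sum_add_sum_compl B, ← hq] at hsum
    have h1 : ∑ x ∈ B, (Finset.univ.filter fun t : K => eval (x + t • p) F = 0).card ≤
        B.card * q :=
      Finset.sum_le_card_nsmul _ _ _ fun x _ => Finset.card_le_univ _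
    have h2 : ∑ x ∈ Bᶜ, (Finset.univ.filter fun t : K => eval (x + t • p) F = 0).card ≤
        Bᶜ.card * e := by
      refine Finset.sum_le_card_nsmul _ _ _ fun x hx => ?_
      have hpx : LinearIndependent K ![p, x] :=
        (LinearIndependent.pair_iff' hp).2 fun s hs => by simp [B, ← hs] at hx
      exact (card_zeros_on_line_le fun h => hno x hpx (lineRes_eq_zero_symm hF h)).trans
        (natDegree_lineRes_le_of_eval_eq_zero hF hFp)
    have h3 : Bᶜ.card + q = q ^ 4 := by
      have := Finset.card_compl_add_card B
      rwa [hB, Fintype.card_fun, Fintype.card_fin] at this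
    rw [hB] at h1
    generalize Bᶜ.card = k at *
    generalize (zerosIn Finset.univ F).card = z at *
    obtain ⟨r, hr⟩ : ∃ r, q = e + r + 1 := ⟨q - e - 1, by omega⟩
    have h4 : q * z ≤ q * q + k * e := by linarith
    have h5 : q * z + e * q ^ 2 = e * q ^ 4 + q ^ 3 := by
      linear_combination q * hZ
    have h6 : k * e + q * e = q ^ 4 * e := by rw [← h3]; ring
    have h7 : q ^ 3 + q * e ≤ q ^ 2 + e * q ^ 2 := by nlinarith
    have h8 : q * (q ^ 2 + e) ≤ q * (q + e * q) := by linarith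
    have h9 := Nat.le_of_mul_le_mul_left h8 (by omega)
    nlinarith

end LinesOnSurface

section TangentPlane

/-- The fibres of a pair of independent linear forms, other than the kernel, are affine planes. -/
theorem exists_affinePlane_eq_fiber {a b : Fin 4 → K} (hab : LinearIndependent K ![a, b])
    {s t : K} (hst : ¬(s = 0 ∧ t = 0)) :
    ∃ a' b' : Fin 4 → K, LinearIndependent K ![a', b'] ∧
      (∀ x, linMap a' x = 0 ∧ linMap b' x = 1 ↔ linMap a x = s ∧ linMap b x = t) ∧
      ∀ x, linMap a x = 0 → linMap b x = 0 → linMap a' x = 0 ∧ linMap b' x = 0 := by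
  obtain ⟨v, hv⟩ := exists_linMap_eq_of_linearIndependent hab ![s, t]
  simp only [Fin.forall_fin_two, Matrix.cons_val_zero, Matrix.cons_val_one] at hv
  have hb0 : b ≠ 0 := by simpa using hab.ne_zero 1
  by_cases ht : t = 0
  · subst ht
    have hs : s ≠ 0 := fun hs => hst ⟨hs, rfl⟩
    have key : ∀ x, linMap b x = 0 ∧ linMap (s⁻¹ • a) x = 1 ↔ linMap a x = s ∧ linMap b x = 0 :=
      fun x => by
        rw [and_comm, linMap_smul_left, inv_mul_eq_one₀ hs, eq_comm (a := s)]
    have hv' := (key v).2 hv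
    exact ⟨b, s⁻¹ • a, linearIndependent_pair_of_linMap hb0 hv'.1 (by simp [hv'.2]), key,
      fun x hax hbx => ⟨hbx, by rw [linMap_smul_left, hax, mul_zero]⟩⟩
  · obtain ⟨w, hw⟩ := exists_linMap_eq_of_linearIndependent hab ![1, 0]
    simp only [Fin.forall_fin_two, Matrix.cons_val_zero, Matrix.cons_val_one] at hw
    have key : ∀ x, linMap (t • a - s • b) x = 0 ∧ linMap (t⁻¹ • b) x = 1 ↔
        linMap a x = s ∧ linMap b x = t := fun x => by
      rw [linMap_sub_left, linMap_smul_left, linMap_smul_left, linMap_smul_left,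
        inv_mul_eq_one₀ ht, eq_comm (a := t), sub_eq_zero]
      refine and_congr_left fun hbx => ?_
      rw [hbx, mul_comm s, mul_right_inj' ht]
    have hv' := (key v).2 hv
    refine ⟨t • a - s • b, t⁻¹ • b, linearIndependent_pair_of_linMap (fun h0 => ht ?_) hv'.1
      (by simp [hv'.2]), key, fun x hax hbx => ⟨?_, ?_⟩⟩
    · have : linMap (t • a - s • b) w = t := by
        rw [linMap_sub_left, linMap_smul_left, linMap_smul_left, hw.1, hw.2, mul_one, mul_zero,
          sub_zero]
      rw [← this, h0]
      simp [linMap_apply]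
    · rw [linMap_sub_left, linMap_smul_left, linMap_smul_left, hax, hbx, mul_zero, mul_zero,
        sub_zero]
    · rw [linMap_smul_left, hbx, mul_zero]

variable [Fintype K]

theorem zerosIn_affinePlane_linForm_mul_add {a b : Fin 4 → K} {F h g : MvPolynomial (Fin 4) K}
    (hFh : F = linForm b * h + linForm a * g) :
    zerosIn (affinePlane a b) F = zerosIn (affinePlane a b) h := by
  ext x
  simp only [mem_zerosIn]
  refine and_congr_right fun hx => ?_
  rw [mem_affinePlane] at hx
  rw [hFh, eval_mul_add_linForm hx.1, map_mul, eval_linForm, hx.2, one_mul]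

theorem card_zerosIn_affinePlane_le_of_line {F : MvPolynomial (Fin 4) K} {e : ℕ}
    (hF : F.IsHomogeneous (e + 1)) (he : e < Fintype.card K)
    (hnoplane : ∀ a : Fin 4 → K, a ≠ 0 → ¬ linForm a ∣ F) {a b p y : Fin 4 → K}
    (hab : LinearIndependent K ![a, b]) (hpy : LinearIndependent K ![p, y])
    (hap : linMap a p = 0) (hay : linMap a y = 0) (hbp : linMap b p = 0) (hby : linMap b y = 0)
    (hline : lineRes p y F = 0) :
    (zerosIn (affinePlane a b) F).card ≤ e * Fintype.card K := by
  obtain ⟨h, g, hh, hFh⟩ := exists_eq_linForm_mul_add hF hab hpy hap hay hbp hby hline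
  rw [zerosIn_affinePlane_linForm_mul_add hFh]
  exact card_zerosIn_affinePlane_le hab hh he
    (not_dvd_of_linForm_mul_add hFh (hnoplane a (by simpa using hab.ne_zero 0)))

open scoped Classical in
theorem card_zerosIn_affinePlane_eq_of_line {F : MvPolynomial (Fin 4) K} {e : ℕ}
    (hF : F.IsHomogeneous (e + 1)) (he : e < Fintype.card K)
    (hnoplane : ∀ a : Fin 4 → K, a ≠ 0 → ¬ linForm a ∣ F)
    (hZ : (zerosIn Finset.univ F).card + e * Fintype.card K =
      e * Fintype.card K ^ 3 + Fintype.card K ^ 2)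
    {a b p y : Fin 4 → K}
    (hab : LinearIndependent K ![a, b]) (hpy : LinearIndependent K ![p, y])
    (hap : linMap a p = 0) (hay : linMap a y = 0) (hbp : linMap b p = 0) (hby : linMap b y = 0)
    (hline : lineRes p y F = 0) :
    (zerosIn (affinePlane a b) F).card = e * Fintype.card K := by
  set q := Fintype.card K with hq
  let f : K × K → ℕ := fun st =>
    ((zerosIn Finset.univ F).filter fun x => (linMap a x, linMap b x) = st).card
  let g : K × K → ℕ := fun st => if st = (0, 0) then q ^ 2 else e * q
  have hf : (zerosIn Finset.univ F).card = ∑ st, f st :=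
    Finset.card_eq_sum_card_fiberwise fun _ _ => Finset.mem_univ _
  have hfg : ∀ st ∈ (Finset.univ : Finset (K × K)), f st ≤ g st := by
    rintro ⟨s, t⟩ -
    by_cases hst : s = 0 ∧ t = 0
    · obtain ⟨rfl, rfl⟩ := hst
      simp only [f, g, if_true]
      rw [hq, ← card_filter_linMap_pair hab 0 0]
      refine Finset.card_le_card fun x hx => ?_
      simp only [Finset.mem_filter, Prod.mk.injEq, Finset.mem_univ, true_and] at hx ⊢
      exact hx.2
    · obtain ⟨a', b', hab', hiff, hker⟩ := exists_affinePlane_eq_fiber hab hst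
      have hp := hker p hap hbp
      have hy := hker y hay hby
      have hle := card_zerosIn_affinePlane_le_of_line hF he hnoplane hab' hpy hp.1 hy.1 hp.2 hy.2
        hline
      simp only [f, g, Prod.mk.injEq, hst, if_false]
      refine le_trans (Finset.card_le_card fun x hx => ?_) hle
      simp only [Finset.mem_filter, mem_zerosIn] at hx
      exact mem_zerosIn.2 ⟨mem_affinePlane.2 ((hiff x).2 hx.2), hx.1.2⟩
  have hg : ∑ st, g st + e * q = e * q ^ 3 + q ^ 2 := by
    have h1 : ((Finset.univ : Finset (K × K)).erase (0, 0)).card + 1 = q * q := by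
      rw [Finset.card_erase_add_one (Finset.mem_univ _), Finset.card_univ, Fintype.card_prod]
    have h2 : ∑ st ∈ (Finset.univ : Finset (K × K)).erase (0, 0), g st =
        ((Finset.univ : Finset (K × K)).erase (0, 0)).card * (e * q) :=
      Finset.sum_const_nat fun st hst => if_neg (Finset.ne_of_mem_erase hst)
    rw [← Finset.add_sum_erase _ _ (Finset.mem_univ ((0, 0) : K × K)), h2]
    simp only [g, if_true]
    linear_combination e * q * h1
  have hsum : ∑ st, f st = ∑ st, g st := by
    rw [← hf]
    omega
  have h01 := (Finset.sum_eq_sum_iff_of_le hfg).1 hsum (0, 1) (Finset.mem_univ _)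
  simp only [f, g, Prod.mk.injEq, one_ne_zero, and_false, if_false] at h01
  rw [← h01]
  congr 1
  ext x
  simp only [mem_zerosIn, mem_affinePlane, Finset.mem_filter, Finset.mem_univ, true_and]
  exact and_comm

theorem exists_isParallelUnion_of_forall_eval_eq_zero {F : MvPolynomial (Fin 4) K} {r : ℕ}
    (hF : F.IsHomogeneous (r + 1 + 1)) (hr : r + 1 = Fintype.card K)
    (hF0 : ∀ x, eval x F = 0) {a b p : Fin 4 → K} {h g : MvPolynomial (Fin 4) K}
    (hFa : ¬ linForm a ∣ F) (hab : LinearIndependent K ![a, b]) (hp : p ≠ 0)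
    (hap : linMap a p = 0) (hbp : linMap b p = 0) (hh : h.IsHomogeneous (r + 1))
    (hFh : F = linForm b * h + linForm a * g)
    (hgrad : ∀ u, linMap a u = 0 → linMap (gradAt F p) u = 0) :
    IsParallelUnion a b h (r + 1) := by
  classical
  have ha : a ≠ 0 := by simpa using hab.ne_zero 0
  obtain ⟨w, hw⟩ := exists_linMap_eq_of_linearIndependent hab ![0, 1]
  simp only [Fin.forall_fin_two, Matrix.cons_val_zero, Matrix.cons_val_one] at hw
  obtain ⟨haw, hbw⟩ := hw
  have hpw : LinearIndependent K ![p, w] := by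
    rw [LinearIndependent.pair_iff' hp]
    rintro s rfl
    rw [map_smul, hbp, smul_zero] at hbw
    exact zero_ne_one hbw
  have hFpw : lineRes p w F = 0 := by
    refine lineRes_eq_zero_of_gradAt ?_ (hgrad w haw) fun t => hF0 _
    rw [← hr]
    exact natDegree_lineRes_le_of_eval_eq_zero hF (hF0 w)
  have hhpw : lineRes p w h = 0 := by
    refine lineRes_mul_eq_zero_left (G := linForm b) ?_ ?_
    · rw [hFh, map_add, map_mul (lineRes p w) (linForm a), lineRes_linForm, hap, haw] at hFpw
      simpa using hFpw
    · rw [lineRes_linForm, hbp, hbw]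
      simp
  obtain ⟨m, ham, hmp, hmw⟩ := exists_linMap_through ha hpw
  obtain ⟨h₂, g₂, hh₂, hhh₂⟩ := exists_eq_linForm_mul_add hh ham hpw hap haw hmp hmw hhpw
  have hh₂a := not_dvd_of_linForm_mul_add hhh₂ (not_dvd_of_linForm_mul_add hFh hFa)
  have hsub : affinePlane a b \ zerosIn (affinePlane a b) (linForm m) ⊆
      zerosIn (affinePlane a b) h₂ := fun x hx => by
    rw [Finset.mem_sdiff, mem_zerosIn, not_and] at hx
    refine mem_zerosIn.2 ⟨hx.1, ?_⟩
    have hx' := mem_affinePlane.1 hx.1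
    have h0 := hF0 x
    rw [hFh, eval_mul_add_linForm hx'.1, map_mul, eval_linForm, hx'.2, one_mul, hhh₂,
      eval_mul_add_linForm hx'.1, map_mul] at h0
    exact (mul_eq_zero.1 h0).resolve_left (hx.2 hx.1)
  have hcard : (affinePlane a b \ zerosIn (affinePlane a b) (linForm m)).card =
      r * Fintype.card K := by
    rw [Finset.card_sdiff_of_subset fun x hx => (mem_zerosIn.1 hx).1, card_affinePlane hab,
      card_zerosIn_affinePlane_linForm (linearIndependent_triple_of_linMap ham haw hbw hmw), ← hr]
    exact Nat.sub_eq_of_eq_add (by ring)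
  have hle := card_zerosIn_affinePlane_le hab hh₂ (by omega) hh₂a
  have heq := Finset.eq_of_subset_of_card_le hsub (hcard ▸ hle)
  refine (isParallelUnion_of_card_eq hab hh₂ (by omega) hh₂a (heq ▸ hcard)).linForm_mul hhh₂ ham
    hp hap hbp hmp haw hbw hmw fun x hax hbx hmx hx => ?_
  have hxA := mem_affinePlane.2 ⟨hax, hbx⟩
  have hx' := mem_zerosIn.2 ⟨hxA, hx⟩
  rw [← heq, Finset.mem_sdiff, mem_zerosIn, eval_linForm] at hx'
  exact hx'.2 ⟨hxA, hmx⟩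

/-- A plane through a line on the surface that is tangent to the surface at a point of this line
cuts out a pencil. -/
theorem exists_isPencil_of_tangent_plane {F : MvPolynomial (Fin 4) K} {e : ℕ}
    (hF : F.IsHomogeneous (e + 1)) (he : e ≤ Fintype.card K)
    (hnoplane : ∀ a : Fin 4 → K, a ≠ 0 → ¬ linForm a ∣ F)
    (hZ : (zerosIn Finset.univ F).card + e * Fintype.card K =
      e * Fintype.card K ^ 3 + Fintype.card K ^ 2)
    {a p y : Fin 4 → K} (ha : a ≠ 0) (hpy : LinearIndependent K ![p, y])
    (hap : linMap a p = 0) (hay : linMap a y = 0) (hline : lineRes p y F = 0)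
    (hgrad : ∀ u, linMap a u = 0 → linMap (gradAt F p) u = 0) :
    ∃ P, IsPencil F (e + 1) (LinearMap.ker (linMap a)) P := by
  obtain ⟨b, hab, hbp, hby⟩ := exists_linMap_through ha hpy
  obtain ⟨h, g, hh, hFh⟩ := exists_eq_linForm_mul_add hF hab hpy hap hay hbp hby hline
  suffices IsParallelUnion a b h e from this.exists_isPencil hab hFh
  rcases he.eq_or_lt with rfl | he
  · obtain ⟨r, hr⟩ := Nat.exists_eq_add_one.2 (Fintype.card_pos (α := K))
    rw [hr] at hF hh ⊢
    exact exists_isParallelUnion_of_forall_eval_eq_zero hF hr.symm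
      (eval_eq_zero_of_card_zerosIn hZ) (hnoplane a ha) hab (by simpa using hpy.ne_zero 0) hap hbp
      hh hFh hgrad
  · refine isParallelUnion_of_card_eq hab hh he
      (not_dvd_of_linForm_mul_add hFh (hnoplane a ha)) ?_
    rw [← zerosIn_affinePlane_linForm_mul_add hFh]
    exact card_zerosIn_affinePlane_eq_of_line hF he hnoplane hZ hab hpy hap hay hbp hby hline

end TangentPlane

section Vertex

variable {F : MvPolynomial (Fin 4) K} {e : ℕ}

theorem IsPencil.eq_ker_gradAt {d : ℕ} {H : Submodule K (Fin 4 → K)}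
    {P : Projectivization K (Fin 4 → K)} (h : IsPencil F d H P) (hd : 2 ≤ d) (hH : IsPlane H)
    (hgrad : gradAt F P.rep ≠ 0) : H = LinearMap.ker (linMap (gradAt F P.rep)) := by
  refine Submodule.eq_of_le_of_finrank_eq (fun u hu => h.gradAt_vertex hd hu) ?_
  have := finrank_ker_linMap hgrad
  rw [IsPlane] at hH
  omega

variable [Fintype K]

theorem exists_isPencil_vertex (hF : F.IsHomogeneous (e + 1)) (he : e ≤ Fintype.card K)
    (hnoplane : ∀ a : Fin 4 → K, a ≠ 0 → ¬ linForm a ∣ F)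
    (hZ : (zerosIn Finset.univ F).card + e * Fintype.card K =
      e * Fintype.card K ^ 3 + Fintype.card K ^ 2)
    {P : Projectivization K (Fin 4 → K)} (hP : eval P.rep F = 0) :
    ∃ H, IsPlane H ∧ IsPencil F (e + 1) H P := by
  obtain ⟨y, hpy, hline⟩ := exists_line_through_point hF he hZ P.rep_nonzero hP
  obtain ⟨a, ha, hap, hay, hker⟩ := exists_tangent_plane_of_line hF hpy hline
  obtain ⟨V, hV⟩ := exists_isPencil_of_tangent_plane hF he hnoplane hZ ha hpy hap hay hline hker
  obtain rfl := hV.eq_vertex hap hP hker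
  refine ⟨_, ?_, hV⟩
  have := finrank_ker_linMap ha
  rw [IsPlane]
  omega

/-- All rational points of the surface are smooth. -/
theorem gradAt_ne_zero (hF : F.IsHomogeneous (e + 1)) (he : e ≤ Fintype.card K)
    (hnoplane : ∀ a : Fin 4 → K, a ≠ 0 → ¬ linForm a ∣ F)
    (hZ : (zerosIn Finset.univ F).card + e * Fintype.card K =
      e * Fintype.card K ^ 3 + Fintype.card K ^ 2)
    {p : Fin 4 → K} (hp : p ≠ 0) (hFp : eval p F = 0) : gradAt F p ≠ 0 := by
  intro hgrad
  obtain ⟨y, hpy, hline⟩ := exists_line_through_point hF he hZ hp hFp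
  have hyp : LinearIndependent K ![y, p] := LinearIndependent.pair_symm_iff.1 hpy
  obtain ⟨a, ha, hay, hap, hker⟩ := exists_tangent_plane_of_line hF hyp
    (lineRes_eq_zero_symm hF hline)
  have hgrad' : ∀ u, linMap a u = 0 → linMap (gradAt F p) u = 0 := fun u _ => by
    simp [hgrad, linMap_apply]
  obtain ⟨V, hV⟩ := exists_isPencil_of_tangent_plane hF he hnoplane hZ ha hpy hap hay hline hgrad'
  have hspan : ∀ v, v ≠ 0 → linMap a v = 0 → eval v F = 0 →
      (∀ u, linMap a u = 0 → linMap (gradAt F v) u = 0) → ∃ s : K, s • v = V.rep :=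
    fun v hv hav hFv hgv => by
      by_contra! hno
      obtain ⟨u, hu, hgu⟩ :=
        hV.exists_gradAt_ne_zero hav hFv ((LinearIndependent.pair_iff' hv).2 hno)
      exact hgu (hgv u hu)
  obtain ⟨s, hs⟩ := hspan p hp hap hFp hgrad'
  obtain ⟨t, ht⟩ := hspan y (by simpa using hpy.ne_zero 1) hay
    (eval_direction_eq_zero_of_lineRes_eq_zero hF hline) hker
  have h0 := LinearIndependent.pair_iff.1 hpy s (-t) (by rw [hs, neg_smul, ht, add_neg_cancel])
  exact V.rep_nonzero (by rw [← hs, h0.1, zero_smul])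

end Vertex

/-- Let `S` be a surface of degree `d` (`2 ≤ d ≤ q+1`) in `P^3` over
`F_q` without `F_q`-plane components attaining the elementary bound, and `Z_S` the set of
`F_q`-planes cutting a planar `F_q`-pencil of degree `d` on `S`. Then sending a plane `H`
to the vertex `v_{S∩H}` gives a bijection `Z_S → S(F_q)`; in particular `#Z_S = N_q(S)`. -/
theorem pencil_planes_biject_with_points (K : Type) [Field K] [Fintype K]
    (d : ℕ) (F : MvPolynomial (Fin 4) K)
    (hhom : F.IsHomogeneous d) (hsf : Squarefree F)
    (hnoplane : ¬ ∃ a : Fin 4 → K, a ≠ 0 ∧ linForm a ∣ F)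
    (hd2 : 2 ≤ d) (hdq : d ≤ Fintype.card K + 1)
    (hN : Nat.card {p : Projectivization K (Fin 4 → K) // MvPolynomial.eval p.rep F = 0} =
      (d - 1) * Fintype.card K ^ 2 + d * Fintype.card K + 1) :
    (∃ f : {H : Submodule K (Fin 4 → K) // IsPlane H ∧ ∃ P, IsPencil F d H P} →
        {p : Projectivization K (Fin 4 → K) // MvPolynomial.eval p.rep F = 0},
      (∀ H, IsPencil F d H.1 (f H).1) ∧ Function.Bijective f) ∧
    Nat.card {H : Submodule K (Fin 4 → K) // IsPlane H ∧ ∃ P, IsPencil F d H P} =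
      Nat.card {p : Projectivization K (Fin 4 → K) // MvPolynomial.eval p.rep F = 0} := by
  obtain ⟨e, rfl⟩ : ∃ e, d = e + 1 := ⟨d - 1, by omega⟩
  have he : e ≤ Fintype.card K := by omega
  have hnoplane' : ∀ a : Fin 4 → K, a ≠ 0 → ¬ linForm a ∣ F :=
    fun a ha hdvd => hnoplane ⟨a, ha, hdvd⟩
  have hZ : (zerosIn Finset.univ F).card + e * Fintype.card K =
      e * Fintype.card K ^ 3 + Fintype.card K ^ 2 := by
    rw [card_zerosIn_univ hhom e.succ_ne_zero, hN, Nat.add_sub_cancel]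
    obtain ⟨r, hr⟩ := Nat.exists_eq_add_one.2 (Fintype.card_pos (α := K))
    rw [hr, Nat.add_sub_cancel]
    ring
  let f : {H : Submodule K (Fin 4 → K) // IsPlane H ∧ ∃ P, IsPencil F (e + 1) H P} →
      {p : Projectivization K (Fin 4 → K) // MvPolynomial.eval p.rep F = 0} :=
    fun H => ⟨H.2.2.choose, H.2.2.choose_spec.eval_vertex hd2⟩
  have hf : ∀ H, IsPencil F (e + 1) H.1 (f H).1 := fun H => H.2.2.choose_spec
  have hbij : Function.Bijective f := by
    constructor
    · intro H₁ H₂ h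
      have hgrad := gradAt_ne_zero hhom he hnoplane' hZ (f H₁).1.rep_nonzero (f H₁).2
      have h₁ := (hf H₁).eq_ker_gradAt hd2 H₁.2.1 hgrad
      rw [h] at hgrad h₁
      exact Subtype.ext (h₁.trans ((hf H₂).eq_ker_gradAt hd2 H₂.2.1 hgrad).symm)
    · rintro ⟨P, hP⟩
      obtain ⟨H, hH, hHP⟩ := exists_isPencil_vertex hhom he hnoplane' hZ hP
      refine ⟨⟨H, hH, P, hHP⟩, Subtype.ext ?_⟩
      exact ((hf ⟨H, hH, P, hHP⟩).eq_vertex hHP.vertex_mem hP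
        fun u hu => hHP.gradAt_vertex hd2 hu).symm
  exact ⟨⟨f, hf, hbij⟩, Nat.card_congr (Equiv.ofBijective f hbij)⟩
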